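/- Let a, b be integers with 1 < a ≤ b, and let G be the graph with vertex set {v_1, …, v_{2b}} ∪ {x} and edge set {{v_{2i−1}, v_{2i}} : 1 ≤ i ≤ a − 1} ∪ {{v_j, v_k} : 2a − 1 ≤ j < k ≤ 2b} ∪ {{v_ℓ, x} : 1 ≤ ℓ ≤ 2b} (the disjoint union of (a − 1) copies of K_2 and one copy of K_{2(b−a+1)}, together with a new vertex x joined to all v_ℓ). Then G is connected, ind-match(G) = a, min-match(G) = match(G) = b, and dim(G) = a. -/

import Mathlib

/-!
Formalization of results from "Matching numbers and dimension of edge ideals"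
by A. Hirano and K. Matsuda.

For a finite simple graph `G`:
* a matching is a set of pairwise disjoint edges;
* a maximal matching is one that cannot be enlarged by any edge;
* an induced matching is a matching such that no edge of `G` meets two
  distinct edges of the matching;
* `matchNum`, `minMatchNum`, `indMatchNum` are the corresponding maximum,
  minimum-maximal and maximum-induced sizes;
* `graphDim K G` is the Krull dimension of `K[V(G)]/I(G)`, where `I(G)` is
  the edge ideal of `G`.
-/

open MvPolynomial
open scoped Classical

noncomputable section

namespace EdgeIdealPaper

variable {V : Type*}

/-- `M` is a matching of `G`: a set of pairwise disjoint edges of `G`. -/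
def IsMatching (G : SimpleGraph V) (M : Finset (Sym2 V)) : Prop :=
  (M : Set (Sym2 V)) ⊆ G.edgeSet ∧
    ∀ e ∈ M, ∀ f ∈ M, e ≠ f → ∀ v : V, v ∈ e → v ∉ f

/-- `M` is a maximal matching of `G`: no edge of `G` outside `M` can be added. -/
def IsMaximalMatching (G : SimpleGraph V) (M : Finset (Sym2 V)) : Prop :=
  IsMatching G M ∧ ∀ e ∈ G.edgeSet, e ∉ M → ¬ IsMatching G (insert e M)

/-- `M` is an induced matching of `G`: a matching such that no edge of `G`
meets two distinct edges of `M`. -/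
def IsInducedMatching (G : SimpleGraph V) (M : Finset (Sym2 V)) : Prop :=
  IsMatching G M ∧ ∀ e ∈ G.edgeSet, ∀ f ∈ M, ∀ g ∈ M, f ≠ g →
    ¬ ((∃ v : V, v ∈ e ∧ v ∈ f) ∧ (∃ v : V, v ∈ e ∧ v ∈ g))

/-- The matching number `match(G)`: maximum size of a matching of `G`. -/
def matchNum (G : SimpleGraph V) : ℕ :=
  sSup {n | ∃ M : Finset (Sym2 V), IsMatching G M ∧ M.card = n}

/-- The minimum matching number `min-match(G)`:
minimum size of a maximal matching of `G`. -/
def minMatchNum (G : SimpleGraph V) : ℕ :=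
  sInf {n | ∃ M : Finset (Sym2 V), IsMaximalMatching G M ∧ M.card = n}

/-- The induced matching number `ind-match(G)`:
maximum size of an induced matching of `G`. -/
def indMatchNum (G : SimpleGraph V) : ℕ :=
  sSup {n | ∃ M : Finset (Sym2 V), IsInducedMatching G M ∧ M.card = n}

/-- The edge ideal `I(G) ⊆ K[x_v : v ∈ V]`, generated by the products
`x_i * x_j` over the edges `{x_i, x_j}` of `G`. -/
def edgeIdeal (K : Type) [Field K] (G : SimpleGraph V) : Ideal (MvPolynomial V K) :=
  Ideal.span {p | ∃ i j : V, G.Adj i j ∧ p = X i * X j}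

/-- `dim(G)`: the Krull dimension of the quotient ring `K[V(G)]/I(G)`. -/
def graphDim (K : Type) [Field K] (G : SimpleGraph V) : WithBot ℕ∞ :=
  ringKrullDim (MvPolynomial V K ⧸ edgeIdeal K G)

/-- The graph of Case 4: the disjoint union of `a - 1` copies of `K_2`
(the edges `{v_{2i-1}, v_{2i}}` for `1 ≤ i ≤ a - 1`, 0-indexed pairs
`(2i-2, 2i-1)`) and one copy of `K_{2(b-a+1)}` (on `v_{2a-1}, …, v_{2b}`,
0-indexed `≥ 2(a-1)`), together with a new vertex `x` (the `Sum.inr` vertex)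
joined to every `v_ℓ`. -/
def caseFourGraph (a b : ℕ) : SimpleGraph (Fin (2 * b) ⊕ Unit) :=
  SimpleGraph.fromRel (fun u w =>
    (∃ i j : Fin (2 * b), u = Sum.inl i ∧ w = Sum.inl j ∧
      (((j : ℕ) = (i : ℕ) + 1 ∧ (i : ℕ) % 2 = 0 ∧ (j : ℕ) < 2 * (a - 1)) ∨
       (2 * (a - 1) ≤ (i : ℕ) ∧ 2 * (a - 1) ≤ (j : ℕ) ∧ i ≠ j))) ∨
    (∃ i : Fin (2 * b), u = Sum.inl i ∧ w = Sum.inr ()))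

/-- The set of vertices covered by a set of edges. -/
def cover (M : Finset (Sym2 V)) : Finset V := M.biUnion Sym2.toFinset

lemma mem_cover {M : Finset (Sym2 V)} {v : V} : v ∈ cover M ↔ ∃ e ∈ M, v ∈ e := by
  simp [cover]

lemma IsMatching.subset {G : SimpleGraph V} {M N : Finset (Sym2 V)} (hM : IsMatching G M)
    (h : N ⊆ M) : IsMatching G N :=
  ⟨fun _ he => hM.1 (h he), fun e he f hf => hM.2 e (h he) f (h hf)⟩

lemma IsMatching.eq_of_mem {G : SimpleGraph V} {M : Finset (Sym2 V)} (hM : IsMatching G M)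
    {e f : Sym2 V} (he : e ∈ M) (hf : f ∈ M) {v : V} (hve : v ∈ e) (hvf : v ∈ f) : e = f := by
  by_contra h
  exact hM.2 e he f hf h v hve hvf

lemma IsMatching.card_cover {G : SimpleGraph V} {M : Finset (Sym2 V)} (hM : IsMatching G M) :
    (cover M).card = 2 * M.card := by
  rw [cover, Finset.card_biUnion, Finset.sum_const_nat (m := 2), mul_comm]
  · exact fun e he => Sym2.card_toFinset_of_not_isDiag e (G.not_isDiag_of_mem_edgeSet (hM.1 he))
  · intro e he f hf hef
    refine Finset.disjoint_left.2 fun v hv hv' => ?_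
    exact hM.2 e he f hf hef v (by simpa using hv) (by simpa using hv')

lemma IsMatching.two_mul_card_le [Fintype V] {G : SimpleGraph V} {M : Finset (Sym2 V)}
    (hM : IsMatching G M) : 2 * M.card ≤ Fintype.card V :=
  hM.card_cover ▸ Finset.card_le_univ _

/-- A matching of maximum size is maximal. -/
lemma IsMatching.isMaximalMatching {G : SimpleGraph V} {M : Finset (Sym2 V)} (hM : IsMatching G M)
    (h : ∀ N, IsMatching G N → N.card ≤ M.card) : IsMaximalMatching G M :=
  ⟨hM, fun _ _ he hN => (h _ hN).not_gt (Finset.card_lt_card (Finset.ssubset_insert he))⟩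

/-- The vertices missed by a maximal matching are pairwise nonadjacent. -/
lemma IsMaximalMatching.not_adj {G : SimpleGraph V} {M : Finset (Sym2 V)}
    (hM : IsMaximalMatching G M) {u w : V} (hu : u ∉ cover M) (hw : w ∉ cover M) :
    ¬ G.Adj u w := by
  intro h
  have key : ∀ f ∈ M, ∀ v ∈ s(u, w), v ∉ f := by
    intro f hf v hv hvf
    rcases Sym2.mem_iff.1 hv with rfl | rfl
    · exact hu (mem_cover.2 ⟨f, hf, hvf⟩)
    · exact hw (mem_cover.2 ⟨f, hf, hvf⟩)
  refine hM.2 s(u, w) h (fun hmem => key _ hmem u (by simp) (by simp)) ⟨?_, ?_⟩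
  · intro e he
    rcases Finset.mem_insert.1 (Finset.mem_coe.1 he) with rfl | he
    · exact h
    · exact hM.1.1 he
  · intro e he f hf hef v hve hvf
    rcases Finset.mem_insert.1 he with rfl | he <;> rcases Finset.mem_insert.1 hf with rfl | hf
    · exact hef rfl
    · exact key f hf v hve hvf
    · exact key e he v hvf hve
    · exact hM.1.2 e he f hf hef v hve hvf

/-- Choosing one endpoint of each edge of an induced matching gives an independent set. -/
lemma IsInducedMatching.card_le_indepNum [Fintype V] {G : SimpleGraph V} {M : Finset (Sym2 V)}
    (hM : IsInducedMatching G M) : M.card ≤ G.indepNum := by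
  have hinj : Set.InjOn (fun e : Sym2 V => e.out.1) M := fun e he f hf h =>
    hM.1.eq_of_mem he hf (Sym2.out_fst_mem e) (by simpa only [h] using Sym2.out_fst_mem f)
  rw [← Finset.card_image_of_injOn hinj]
  refine SimpleGraph.IsIndepSet.card_le_indepNum ?_
  intro u hu w hw huw hadj
  obtain ⟨e, he, rfl⟩ := Finset.mem_image.1 (Finset.mem_coe.1 hu)
  obtain ⟨f, hf, rfl⟩ := Finset.mem_image.1 (Finset.mem_coe.1 hw)
  exact hM.2 s(e.out.1, f.out.1) hadj e he f hf (by rintro rfl; exact huw rfl)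
    ⟨⟨_, Sym2.mem_mk_left _ _, Sym2.out_fst_mem e⟩, ⟨_, Sym2.mem_mk_right _ _, Sym2.out_fst_mem f⟩⟩

/-- The Krull dimension of a ring is bounded by the dimensions of its quotients by primes. -/
lemma ringKrullDim_le_of_forall_isPrime {R : Type*} [CommRing R] {d : WithBot ℕ∞}
    (h : ∀ P : Ideal R, P.IsPrime → ringKrullDim (R ⧸ P) ≤ d) : ringKrullDim R ≤ d := by
  refine iSup_le fun l => le_trans ?_ (h l.head.asIdeal l.head.isPrime)
  rw [ringKrullDim_quotient]
  let l' : LTSeries (PrimeSpectrum.zeroLocus (R := R) l.head.asIdeal) :=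
    { length := l.length
      toFun := fun i => ⟨l i, LTSeries.head_le l i⟩
      step := fun i => l.step i }
  exact Order.LTSeries.length_le_krullDim l'

lemma graphDim_le_indepNum [Fintype V] (K : Type) [Field K] (G : SimpleGraph V) :
    graphDim K G ≤ (G.indepNum : WithBot ℕ∞) := by
  refine ringKrullDim_le_of_forall_isPrime fun P hP => ?_
  let π : MvPolynomial V K →ₐ[K] (MvPolynomial V K ⧸ edgeIdeal K G) ⧸ P :=
    (Ideal.Quotient.mkₐ K P).comp (Ideal.Quotient.mkₐ K (edgeIdeal K G))
  have hπ : Function.Surjective π :=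
    (Ideal.Quotient.mkₐ_surjective K P).comp (Ideal.Quotient.mkₐ_surjective K _)
  let S : Finset V := Finset.univ.filter fun v => π (X v) ≠ 0
  have hS : G.IsIndepSet (S : Set V) := by
    intro u hu w hw _ hadj
    have h0 : π (X u * X w) = 0 := by
      have : Ideal.Quotient.mk (edgeIdeal K G) (X u * X w) = 0 :=
        Ideal.Quotient.eq_zero_iff_mem.2 (Ideal.subset_span ⟨u, w, hadj, rfl⟩)
      simp only [π, AlgHom.comp_apply, Ideal.Quotient.mkₐ_eq_mk, this, map_zero]
    rw [map_mul] at h0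
    rcases mul_eq_zero.1 h0 with h | h
    · exact (Finset.mem_filter.1 (Finset.mem_coe.1 hu)).2 h
    · exact (Finset.mem_filter.1 (Finset.mem_coe.1 hw)).2 h
  let φ : MvPolynomial S K →ₐ[K] (MvPolynomial V K ⧸ edgeIdeal K G) ⧸ P :=
    aeval fun v => π (X v.1)
  have hφ : Function.Surjective φ := by
    rw [← AlgHom.range_eq_top, eq_top_iff, ← (AlgHom.range_eq_top π).2 hπ,
      ← Algebra.map_top, ← MvPolynomial.adjoin_range_X, AlgHom.map_adjoin, Algebra.adjoin_le_iff]
    rintro _ ⟨_, ⟨v, rfl⟩, rfl⟩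
    by_cases hv : π (X v) = 0
    · exact ⟨0, by simpa using hv.symm⟩
    · exact ⟨X ⟨v, by simpa [S] using hv⟩, by simp [φ]⟩
  refine (ringKrullDim_le_of_surjective φ.toRingHom hφ).trans ?_
  rw [MvPolynomial.ringKrullDim_of_isNoetherianRing, ringKrullDim_eq_zero_of_field, zero_add,
    Nat.card_eq_fintype_card, Fintype.card_coe]
  exact_mod_cast hS.card_le_indepNum

lemma card_le_graphDim (K : Type) [Field K] {G : SimpleGraph V} {S : Finset V}
    (hS : G.IsIndepSet (S : Set V)) : (S.card : WithBot ℕ∞) ≤ graphDim K G := by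
  let φ : MvPolynomial V K →ₐ[K] MvPolynomial S K :=
    aeval fun v => if h : v ∈ S then X ⟨v, h⟩ else 0
  have hφ : Function.Surjective φ := fun p => ⟨rename Subtype.val p, by
    rw [aeval_rename]
    convert aeval_X_left_apply p
    ext1 v
    simp⟩
  have hI : ∀ p ∈ edgeIdeal K G, φ.toRingHom p = 0 := by
    intro p hp
    refine (Ideal.span_le.2 ?_ : edgeIdeal K G ≤ RingHom.ker φ.toRingHom) hp
    rintro _ ⟨u, w, hadj, rfl⟩
    by_cases hu : u ∈ S
    · by_cases hw : w ∈ S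
      · exact (hS hu hw hadj.ne hadj).elim
      · simp [φ, hw]
    · simp [φ, hu]
  have := ringKrullDim_le_of_surjective (Ideal.Quotient.lift (edgeIdeal K G) φ.toRingHom hI)
    (Ideal.Quotient.lift_surjective_of_surjective _ hI hφ)
  rwa [MvPolynomial.ringKrullDim_of_isNoetherianRing, ringKrullDim_eq_zero_of_field, zero_add,
    Nat.card_eq_fintype_card, Fintype.card_coe] at this

/-- The dimension of a finite graph is its independence number. -/
theorem graphDim_eq_indepNum [Fintype V] (K : Type) [Field K] (G : SimpleGraph V) :
    graphDim K G = (G.indepNum : WithBot ℕ∞) := by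
  obtain ⟨S, hS⟩ := G.exists_isNIndepSet_indepNum
  exact (graphDim_le_indepNum K G).antisymm (hS.card_eq ▸ card_le_graphDim K hS.isIndepSet)

/-- The index of the component of `caseFourGraph a b` minus its cone vertex containing `n`. -/
def component (a n : ℕ) : ℕ := min (n / 2) (a - 1)

lemma caseFourGraph_adj_inl_inl {a b : ℕ} {i j : Fin (2 * b)} :
    (caseFourGraph a b).Adj (Sum.inl i) (Sum.inl j) ↔
      i ≠ j ∧ component a i = component a j := by
  have h1 := Fin.ext_iff (a := i) (b := j)
  simp only [caseFourGraph, SimpleGraph.fromRel_adj, component, Sum.inl.injEq, reduceCtorEq,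
    and_false, exists_false, or_false, ne_eq, h1]
  constructor
  · rintro ⟨hne, ⟨i', j', rfl, rfl, h⟩ | ⟨i', j', rfl, rfl, h⟩⟩ <;> omega
  · rintro ⟨hne, h⟩
    refine ⟨hne, ?_⟩
    by_cases hij : (i : ℕ) < j
    · exact Or.inl ⟨i, j, rfl, rfl, by omega⟩
    · exact Or.inr ⟨j, i, rfl, rfl, by omega⟩

lemma caseFourGraph_adj_inl_inr {a b : ℕ} (i : Fin (2 * b)) (t : Unit) :
    (caseFourGraph a b).Adj (Sum.inl i) (Sum.inr t) := by
  simp [caseFourGraph]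

lemma caseFourGraph_connected (a b : ℕ) : (caseFourGraph a b).Connected := by
  rw [SimpleGraph.connected_iff_exists_forall_reachable]
  refine ⟨Sum.inr (), ?_⟩
  rintro (i | _)
  · exact (caseFourGraph_adj_inl_inr i ()).symm.reachable
  · exact SimpleGraph.Reachable.refl _

/-- The edges `{v_{2i-1}, v_{2i}}` for `1 ≤ i ≤ n`. -/
def pairs (n b : ℕ) (h : n ≤ b) : Finset (Sym2 (Fin (2 * b) ⊕ Unit)) :=
  Finset.univ.image fun i : Fin n =>
    s(Sum.inl ⟨2 * i, by omega⟩, Sum.inl ⟨2 * i + 1, by omega⟩)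

lemma exists_forall_mem_iff_of_mem_pairs {n b : ℕ} {h : n ≤ b} {e : Sym2 (Fin (2 * b) ⊕ Unit)}
    (he : e ∈ pairs n b h) :
    ∃ k < n, ∀ v, v ∈ e ↔ ∃ i : Fin (2 * b), v = Sum.inl i ∧ (i : ℕ) / 2 = k := by
  obtain ⟨k, -, rfl⟩ := Finset.mem_image.1 he
  refine ⟨k, k.2, fun v => ?_⟩
  rw [Sym2.mem_iff]
  constructor
  · rintro (rfl | rfl)
    · exact ⟨_, rfl, by simp⟩
    · exact ⟨_, rfl, by simp only; omega⟩
  · rintro ⟨i, rfl, hi⟩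
    simp only [Sum.inl.injEq, Fin.ext_iff]
    omega

lemma card_pairs {n b : ℕ} (h : n ≤ b) : (pairs n b h).card = n := by
  rw [pairs, Finset.card_image_of_injective, Finset.card_univ, Fintype.card_fin]
  intro i j hij
  simp only [Sym2.eq_iff, Sum.inl.injEq, Fin.ext_iff] at hij
  omega

lemma isMatching_pairs {n a b : ℕ} (h : n ≤ b) : IsMatching (caseFourGraph a b) (pairs n b h) := by
  refine ⟨?_, ?_⟩
  · intro e he
    obtain ⟨k, -, rfl⟩ := Finset.mem_image.1 (Finset.mem_coe.1 he)
    rw [SimpleGraph.mem_edgeSet, caseFourGraph_adj_inl_inl]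
    simp only [component, ne_eq, Fin.ext_iff]
    omega
  · intro e he f hf hef v hve hvf
    obtain ⟨k, -, hk⟩ := exists_forall_mem_iff_of_mem_pairs he
    obtain ⟨l, -, hl⟩ := exists_forall_mem_iff_of_mem_pairs hf
    obtain ⟨i, rfl, hi⟩ := (hk v).1 hve
    obtain ⟨j, hj, hj'⟩ := (hl _).1 hvf
    obtain rfl := Sum.inl.inj hj
    exact hef (Sym2.ext fun v => by rw [hk, hl, ← hi, ← hj'])

lemma isInducedMatching_pairs {a b : ℕ} (h : a ≤ b) :
    IsInducedMatching (caseFourGraph a b) (pairs a b h) := by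
  refine ⟨isMatching_pairs h, ?_⟩
  rintro e he f hf g hg hfg ⟨⟨u, hue, huf⟩, w, hwe, hwg⟩
  obtain ⟨k, hka, hk⟩ := exists_forall_mem_iff_of_mem_pairs hf
  obtain ⟨l, hla, hl⟩ := exists_forall_mem_iff_of_mem_pairs hg
  obtain ⟨i, rfl, hi⟩ := (hk u).1 huf
  obtain ⟨j, rfl, hj⟩ := (hl w).1 hwg
  have hij : component a i = component a j := by
    by_cases hij : i = j
    · rw [hij]
    · have hs : e = s(Sum.inl i, Sum.inl j) :=
        (Sym2.mem_and_mem_iff (by simpa using hij)).1 ⟨hue, hwe⟩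
      rw [hs, SimpleGraph.mem_edgeSet, caseFourGraph_adj_inl_inl] at he
      exact he.2
  have hkl : k = l := by
    simp only [component] at hij
    omega
  subst hkl
  exact hfg (Sym2.ext fun v => by rw [hk, hl])

lemma caseFourGraph_card_le_of_isIndepSet {a b : ℕ} (ha : 0 < a)
    {S : Finset (Fin (2 * b) ⊕ Unit)}
    (hS : (caseFourGraph a b).IsIndepSet (S : Set (Fin (2 * b) ⊕ Unit))) : S.card ≤ a := by
  by_cases hx : Sum.inr () ∈ S
  · have : S ⊆ {Sum.inr ()} := by
      rintro (i | _) hi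
      · exact (hS hi hx (by simp) (caseFourGraph_adj_inl_inr i ())).elim
      · simp
    exact (Finset.card_le_card this).trans (by simpa using Nat.one_le_of_lt ha)
  · rw [← Finset.card_range a]
    refine Finset.card_le_card_of_injOn (Sum.elim (fun i => component a i) fun _ => 0) ?_ ?_
    · rintro (i | _) _
      · simp only [Sum.elim_inl, component, Finset.coe_range, Set.mem_Iio]
        omega
      · simpa using ha
    · rintro (i | _) hi (j | _) hj hij
      · by_contra hne
        exact hS hi hj hne (caseFourGraph_adj_inl_inl.2 ⟨by simpa using hne, hij⟩)
      · exact (hx hj).elim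
      · exact (hx hi).elim
      · rfl

lemma caseFourGraph_indepNum {a b : ℕ} (ha : 0 < a) (hab : a ≤ b) :
    (caseFourGraph a b).indepNum = a := by
  refine le_antisymm ?_ ?_
  · obtain ⟨S, hS⟩ := (caseFourGraph a b).exists_isNIndepSet_indepNum
    exact hS.card_eq ▸ caseFourGraph_card_le_of_isIndepSet ha hS.isIndepSet
  · exact (card_pairs hab).symm.le.trans (isInducedMatching_pairs hab).card_le_indepNum

/-- The vertices `v_ℓ` of `caseFourGraph a b` lying in the component of index `c`. -/
def componentVerts (a b c : ℕ) : Finset (Fin (2 * b) ⊕ Unit) :=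
  (Finset.univ.filter fun i : Fin (2 * b) => component a i = c).map Function.Embedding.inl

lemma inl_mem_componentVerts {a b c : ℕ} {i : Fin (2 * b)} :
    Sum.inl i ∈ componentVerts a b c ↔ component a i = c := by
  simp [componentVerts]

lemma inr_notMem_componentVerts {a b c : ℕ} {t : Unit} :
    Sum.inr t ∉ componentVerts a b c := by
  simp [componentVerts]

lemma even_card_componentVerts (a b c : ℕ) : Even (componentVerts a b c).card := by
  have h : componentVerts a b c =
      cover ((pairs b b le_rfl).filter fun e => ∀ v ∈ e, v ∈ componentVerts a b c) := by
    ext v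
    rw [mem_cover]
    constructor
    · rcases v with i | _
      · intro hi
        have hp : s(Sum.inl ⟨2 * (i / 2 : ℕ), by omega⟩, Sum.inl ⟨2 * (i / 2 : ℕ) + 1, by omega⟩) ∈
            pairs b b le_rfl :=
          Finset.mem_image.2 ⟨⟨i / 2, by omega⟩, Finset.mem_univ _, rfl⟩
        refine ⟨_, Finset.mem_filter.2 ⟨hp, ?_⟩, ?_⟩
        · intro w hw
          rw [inl_mem_componentVerts] at hi
          rcases Sym2.mem_iff.1 hw with rfl | rfl <;>
            · rw [inl_mem_componentVerts, ← hi]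
              simp only [component]
              omega
        · simp only [Sym2.mem_iff, Sum.inl.injEq, Fin.ext_iff]
          omega
      · exact fun hv => (inr_notMem_componentVerts hv).elim
    · rintro ⟨e, he, hve⟩
      exact (Finset.mem_filter.1 he).2 v hve
  rw [h, ((isMatching_pairs (a := a) le_rfl).subset (Finset.filter_subset _ _)).card_cover]
  exact even_two_mul _

/-- A maximal matching using the edge `{v_k, x}` covers all vertices in the other components. -/
lemma IsMaximalMatching.inl_mem_cover {a b : ℕ} {M : Finset (Sym2 (Fin (2 * b) ⊕ Unit))}
    (hM : IsMaximalMatching (caseFourGraph a b) M) {i k : Fin (2 * b)}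
    (hk : s(Sum.inr (), Sum.inl k) ∈ M) (hik : component a i ≠ component a k) :
    Sum.inl i ∈ cover M := by
  by_contra hi
  have h : (componentVerts a b (component a i)).erase (Sum.inl i) =
      cover (M.filter fun e => ∀ v ∈ e, v ∈ componentVerts a b (component a i)) := by
    ext v
    rw [mem_cover, Finset.mem_erase]
    constructor
    · rintro ⟨hvi, hv⟩
      rcases v with j | _
      · rw [inl_mem_componentVerts] at hv
        have hj : Sum.inl j ∈ cover M := by
          by_contra hj
          exact hM.not_adj hj hi (caseFourGraph_adj_inl_inl.2 ⟨by simpa using hvi, hv⟩)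
        obtain ⟨e, he, hje⟩ := mem_cover.1 hj
        refine ⟨e, Finset.mem_filter.2 ⟨he, ?_⟩, hje⟩
        rintro (l | _) hl
        · rw [inl_mem_componentVerts]
          by_cases hjl : j = l
          · rw [← hjl, hv]
          · have hs : e = s(Sum.inl j, Sum.inl l) :=
              (Sym2.mem_and_mem_iff (by simpa using hjl)).1 ⟨hje, hl⟩
            have hadj := hM.1.1 he
            rw [hs, SimpleGraph.mem_edgeSet, caseFourGraph_adj_inl_inl] at hadj
            exact hadj.2.symm.trans hv
        · rw [hM.1.eq_of_mem he hk hl (Sym2.mem_mk_left _ _)] at hje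
          have hjk : j = k := by simpa using hje
          exact (hik (hv.symm.trans (congrArg _ (congrArg _ hjk)))).elim
      · exact (inr_notMem_componentVerts hv).elim
    · rintro ⟨e, he, hve⟩
      obtain ⟨he, hsub⟩ := Finset.mem_filter.1 he
      refine ⟨?_, hsub v hve⟩
      rintro rfl
      exact hi (mem_cover.2 ⟨e, he, hve⟩)
  have hmem : (Sum.inl i : Fin (2 * b) ⊕ Unit) ∈ componentVerts a b (component a i) :=
    inl_mem_componentVerts.2 rfl
  have hcard := Finset.card_erase_add_one hmem
  rw [h, (hM.1.subset (Finset.filter_subset _ _)).card_cover] at hcard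
  obtain ⟨m, hm⟩ := even_card_componentVerts a b (component a i)
  omega

lemma IsMaximalMatching.card_compl_cover_le_one {a b : ℕ}
    {M : Finset (Sym2 (Fin (2 * b) ⊕ Unit))} (hM : IsMaximalMatching (caseFourGraph a b) M) :
    (cover M)ᶜ.card ≤ 1 := by
  rw [Finset.card_le_one]
  intro u hu w hw
  rw [Finset.mem_compl] at hu hw
  by_contra huw
  rcases u with i | _ <;> rcases w with j | _
  · have hij : component a i ≠ component a j := fun h =>
      hM.not_adj hu hw (caseFourGraph_adj_inl_inl.2 ⟨by simpa using huw, h⟩)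
    have hx : Sum.inr () ∈ cover M := by
      by_contra hx
      exact hM.not_adj hu hx (caseFourGraph_adj_inl_inr i ())
    obtain ⟨e, he, hxe⟩ := mem_cover.1 hx
    obtain ⟨k | _, rfl⟩ := hxe
    · by_cases hik : component a i = component a k
      · exact hw (hM.inl_mem_cover he fun hjk => hij (hik.trans hjk.symm))
      · exact hu (hM.inl_mem_cover he hik)
    · exact ((caseFourGraph a b).irrefl (hM.1.1 he)).elim
  · exact hM.not_adj hu hw (caseFourGraph_adj_inl_inr i ())
  · exact hM.not_adj hw hu (caseFourGraph_adj_inl_inr j ())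
  · exact huw rfl

lemma IsMatching.card_le_of_caseFourGraph {a b : ℕ} {M : Finset (Sym2 (Fin (2 * b) ⊕ Unit))}
    (hM : IsMatching (caseFourGraph a b) M) : M.card ≤ b := by
  have := hM.two_mul_card_le
  simp only [Fintype.card_sum, Fintype.card_fin, Fintype.card_unit] at this
  omega

lemma IsMaximalMatching.card_eq_of_caseFourGraph {a b : ℕ}
    {M : Finset (Sym2 (Fin (2 * b) ⊕ Unit))} (hM : IsMaximalMatching (caseFourGraph a b) M) :
    M.card = b := by
  have h1 := hM.card_compl_cover_le_one
  have h2 := Finset.card_add_card_compl (cover M)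
  rw [hM.1.card_cover] at h2
  simp only [Fintype.card_sum, Fintype.card_fin, Fintype.card_unit] at h2
  omega

lemma isMaximalMatching_pairs (a b : ℕ) :
    IsMaximalMatching (caseFourGraph a b) (pairs b b le_rfl) :=
  (isMatching_pairs le_rfl).isMaximalMatching fun _ hN =>
    hN.card_le_of_caseFourGraph.trans (card_pairs le_rfl).ge

/-- For `1 < a ≤ b`, the graph `caseFourGraph a b` is connected and has
`ind-match = a`, `min-match = match = b` and `dim = a`. -/
theorem caseFourGraph_invariants (a b : ℕ) (ha : 1 < a) (hab : a ≤ b)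
    (K : Type) [Field K] :
    (caseFourGraph a b).Connected ∧ indMatchNum (caseFourGraph a b) = a ∧
      minMatchNum (caseFourGraph a b) = b ∧ matchNum (caseFourGraph a b) = b ∧
      graphDim K (caseFourGraph a b) = (a : WithBot ℕ∞) := by
  have hindep := caseFourGraph_indepNum (by omega : 0 < a) hab
  refine ⟨caseFourGraph_connected a b, IsGreatest.csSup_eq ⟨?_, ?_⟩, IsLeast.csInf_eq ⟨?_, ?_⟩,
    IsGreatest.csSup_eq ⟨?_, ?_⟩, by rw [graphDim_eq_indepNum, hindep]⟩
  · exact ⟨_, isInducedMatching_pairs hab, card_pairs hab⟩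
  · rintro _ ⟨M, hM, rfl⟩
    exact hM.card_le_indepNum.trans hindep.le
  · exact ⟨_, isMaximalMatching_pairs a b, card_pairs le_rfl⟩
  · rintro _ ⟨M, hM, rfl⟩
    exact hM.card_eq_of_caseFourGraph.ge
  · exact ⟨_, isMatching_pairs le_rfl, card_pairs le_rfl⟩
  · rintro _ ⟨M, hM, rfl⟩
    exact hM.card_le_of_caseFourGraph

end EdgeIdealPaper
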